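/- In the one-suit game the player having the highest card wins in finite time: for every state (L, R) over the deck {1, …, n} with n an entry of L and R ≠ [], some state of the form (L₁, []) is reachable from (L, R). -/

import Mathlib

/-- A game state: the hands of the left and right player. -/
abbrev WarState := List ℕ × List ℕ

/-- A state is final if one of the players has no cards. -/
def Final (s : WarState) : Prop := s.1 = [] ∨ s.2 = []

/-- The move relation of the one-suit game of War. -/
inductive Move : WarState → WarState → Prop
  | leftOwnLast (a b : ℕ) (L R : List ℕ) (h : a > b) :
      Move (a :: L, b :: R) (L ++ [a, b], R)
  | leftRivalLast (a b : ℕ) (L R : List ℕ) (h : a > b) :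
      Move (a :: L, b :: R) (L ++ [b, a], R)
  | rightOwnLast (a b : ℕ) (L R : List ℕ) (h : b > a) :
      Move (a :: L, b :: R) (L, R ++ [a, b])
  | rightRivalLast (a b : ℕ) (L R : List ℕ) (h : b > a) :
      Move (a :: L, b :: R) (L, R ++ [b, a])

/-- Reachability: the reflexive-transitive closure of the move relation. -/
def Reachable : WarState → WarState → Prop := Relation.ReflTransGen Move

/-- A state is over the deck `{1, …, n}`. -/
def OverDeck (n : ℕ) (s : WarState) : Prop := (s.1 ++ s.2).Perm (List.range' 1 n)

/-- The states over the deck `{1, …, n}` with `n` on the left from which the left player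
cannot win. -/
def unwinnable (n : ℕ) : Set WarState :=
  {s | OverDeck n s ∧ n ∈ s.1 ∧ ∀ L₁, ¬ Reachable s (L₁, [])}

/-- Play one trick, the flag `o` telling in which order the cards are returned, and record
whether the left player took the trick. -/
def playTrick : WarState × Bool → WarState × Bool
  | ((a :: L, b :: R), o) =>
    if b < a then ((L ++ (if o then [a, b] else [b, a]), R), true)
    else ((L, R ++ (if o then [a, b] else [b, a])), false)
  | p => p

theorem finite_overDeck (n : ℕ) : {s | OverDeck n s}.Finite := by
  refine (((List.range' 1 n).permutations.finite_toSet).image2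
    (fun l k => (l.take k, l.drop k)) (Set.finite_Iic n)).subset ?_
  rintro ⟨L, R⟩ h
  refine ⟨L ++ R, List.mem_permutations.2 h, L.length, ?_, by simp⟩
  have := List.Perm.length_eq h
  simp only [List.length_append, List.length_range'] at this
  rw [Set.mem_Iic]
  omega

/-- An unwinnable state has two nonempty hands with different top cards. -/
theorem unwinnable.exists_cons {n : ℕ} {s : WarState} (hs : s ∈ unwinnable n) :
    ∃ a b L R, s = (a :: L, b :: R) ∧ a ≠ b := by
  obtain ⟨L, R⟩ := s
  obtain ⟨hd, hm, hr⟩ := hs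
  rcases L with _ | ⟨a, L⟩
  · simp at hm
  rcases R with _ | ⟨b, R⟩
  · exact absurd .refl (hr _)
  refine ⟨a, b, L, R, rfl, ?_⟩
  rintro rfl
  have := (List.Perm.nodup_iff hd).2 List.nodup_range'
  simp at this

theorem unwinnable.of_move {n : ℕ} {s t : WarState} (hs : s ∈ unwinnable n) (h : Move s t) :
    t ∈ unwinnable n := by
  obtain ⟨hd, hm, hr⟩ := hs
  refine ⟨?_, ?_, fun L₁ hL => hr L₁ (.head h hL)⟩
  · refine List.Perm.trans ?_ hd
    rw [List.perm_iff_count]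
    intro c
    cases h <;> simp [List.count_cons] <;> omega
  · have hle : ∀ c ∈ s.1 ++ s.2, c ≤ n := fun c hc => by
      have := List.mem_range'_1.1 ((List.Perm.mem_iff hd).1 hc)
      omega
    cases h <;> simp only [List.forall_mem_append, List.forall_mem_cons] at hle <;> grind

theorem mapsTo_playTrick (n : ℕ) :
    Set.MapsTo playTrick (unwinnable n ×ˢ Set.univ) (unwinnable n ×ˢ Set.univ) := by
  rintro ⟨s, o⟩ ⟨hs, -⟩
  refine ⟨?_, trivial⟩
  obtain ⟨a, b, L, R, rfl, hab⟩ := unwinnable.exists_cons hs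
  refine unwinnable.of_move hs ?_
  rcases lt_or_gt_of_ne hab with h | h
  · cases o
    · simpa [playTrick, h.not_gt] using Move.rightRivalLast a b L R h
    · simpa [playTrick, h.not_gt] using Move.rightOwnLast a b L R h
  · cases o
    · simpa [playTrick, h] using Move.leftRivalLast a b L R h
    · simpa [playTrick, h] using Move.leftOwnLast a b L R h

theorem injOn_playTrick (n : ℕ) : Set.InjOn playTrick (unwinnable n ×ˢ Set.univ) := by
  rintro ⟨s, o⟩ ⟨hs, -⟩ ⟨t, o'⟩ ⟨ht, -⟩ h
  obtain ⟨a, b, L, R, rfl, hab⟩ := unwinnable.exists_cons hs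
  obtain ⟨a', b', L', R', rfl, hab'⟩ := unwinnable.exists_cons ht
  have key : ∀ {l l' : List ℕ} {c d c' d' : ℕ}, l ++ [c, d] = l' ++ [c', d'] →
      l = l' ∧ c = c' ∧ d = d' := fun h => by
    simpa using List.append_inj' h rfl
  simp only [playTrick] at h
  split_ifs at h <;> simp only [Prod.mk.injEq] at h <;> grind

theorem unwinnable.exists_shorter {n : ℕ} {s : WarState} (hs : s ∈ unwinnable n) :
    ∃ t ∈ unwinnable n, t.2.length < s.2.length := by
  have hfin : (unwinnable n ×ˢ (Set.univ : Set Bool)).Finite :=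
    ((finite_overDeck n).subset fun _ h => h.1).prod Set.finite_univ
  obtain ⟨⟨t, o⟩, ⟨ht, -⟩, h⟩ :=
    ((hfin.injOn_iff_bijOn_of_mapsTo (mapsTo_playTrick n)).1 (injOn_playTrick n)).surjOn
      (show (s, false) ∈ _ from ⟨hs, trivial⟩)
  refine ⟨t, ht, ?_⟩
  obtain ⟨a, b, L, R, rfl, -⟩ := unwinnable.exists_cons ht
  simp only [playTrick] at h
  split_ifs at h <;> simp only [Prod.mk.injEq] at h <;> grind

theorem unwinnable_eq_empty (n : ℕ) : unwinnable n = ∅ := by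
  by_contra hne
  obtain ⟨s, hs, hmin⟩ := exists_minimalFor_of_wellFoundedLT (· ∈ unwinnable n)
    (fun s : WarState => s.2.length) (Set.nonempty_iff_ne_empty.2 hne)
  obtain ⟨t, ht, hlt⟩ := unwinnable.exists_shorter hs
  exact (hmin ht hlt.le).not_gt hlt

/-- In the one-suit game the player holding the highest card `n` can win in
finite time: from any state over the deck `{1, …, n}` with `n` in the left
player's hand, a state in which the right player has no cards is reachable. -/
theorem war_highest_card_wins (n : ℕ) (L R : List ℕ)
    (hdeck : OverDeck n (L, R)) (hn : n ∈ L) (hR : R ≠ []) :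
    ∃ L₁ : List ℕ, Reachable (L, R) (L₁, []) := by
  by_contra! h
  exact Set.eq_empty_iff_forall_notMem.1 (unwinnable_eq_empty n) (L, R) ⟨hdeck, hn, h⟩
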